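/- The set of all Mather measures is a nonempty compact subset of the space of Borel probability measures on ℝ^N × ℝ^N endowed with the narrow topology. -/

import Mathlib

open MeasureTheory Set
open scoped RealInnerProductSpace

noncomputable section

abbrev Euc (N : ℕ) := EuclideanSpace ℝ (Fin N)

/-- `u` is an (a.e.) subsolution of `H = a` in `ℝ^N`. -/
def IsSubsol {N : ℕ} (H : Euc N × Euc N → ℝ) (a : ℝ) (u : Euc N → ℝ) : Prop :=
  LocallyLipschitz u ∧
    ∀ᵐ x : Euc N ∂volume, DifferentiableAt ℝ u x → H (x, gradient u x) ≤ a

/-- `u` is an (a.e.) subsolution of the discounted equation `λ u + H(x,Du) = 0`. -/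
def IsDiscSubsol {N : ℕ} (H : Euc N × Euc N → ℝ) (lam : ℝ) (u : Euc N → ℝ) : Prop :=
  LocallyLipschitz u ∧
    ∀ᵐ x : Euc N ∂volume, DifferentiableAt ℝ u x →
      lam * u x + H (x, gradient u x) ≤ 0

/-- The Lagrangian associated with `H` via the Fenchel transform. -/
def Lag {N : ℕ} (H : Euc N × Euc N → ℝ) : Euc N × Euc N → ℝ :=
  fun z => sSup (Set.range fun p : Euc N => ⟪p, z.2⟫ - H (z.1, p))

/-- `u` is a subsolution for the generalized Lagrangian `Φ`. -/
def SubsolFor {N : ℕ} (Φ : Euc N × Euc N → ℝ) (u : Euc N → ℝ) : Prop :=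
  LocallyLipschitz u ∧
    ∀ᵐ x : Euc N ∂volume, DifferentiableAt ℝ u x →
      ∀ q : Euc N, fderiv ℝ u x q ≤ Φ (x, q)

/-- `u` is a `λ`-discounted subsolution for the generalized Lagrangian `Φ`. -/
def DiscSubsolFor {N : ℕ} (lam : ℝ) (Φ : Euc N × Euc N → ℝ) (u : Euc N → ℝ) : Prop :=
  LocallyLipschitz u ∧
    ∀ᵐ x : Euc N ∂volume, DifferentiableAt ℝ u x →
      ∀ q : Euc N, lam * u x + fderiv ℝ u x q ≤ Φ (x, q)

/-- A Mather measure for the ergodic problem. -/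
def MatherMeasure {N : ℕ} (H : Euc N × Euc N → ℝ) (μ : Measure (Euc N × Euc N)) : Prop :=
  IsProbabilityMeasure μ ∧ Integrable (Lag H) μ ∧ (∫ z, Lag H z ∂μ) = 0 ∧
    ∀ Φ : Euc N × Euc N → ℝ, Continuous Φ → BddBelow (Set.range Φ) →
      (∃ u, SubsolFor Φ u) → (Integrable Φ μ → 0 ≤ ∫ z, Φ z ∂μ)

/-- A `(λ,z)`-Mather measure (relative to the maximal discounted solution `um`). -/
def DiscMatherMeasure {N : ℕ} (H : Euc N × Euc N → ℝ) (lam : ℝ) (z : Euc N)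
    (um : Euc N → ℝ) (μ : Measure (Euc N × Euc N)) : Prop :=
  IsProbabilityMeasure μ ∧ Integrable (Lag H) μ ∧ (∫ w, Lag H w ∂μ) = lam * um z ∧
    ∀ Φ : Euc N × Euc N → ℝ, Continuous Φ → BddBelow (Set.range Φ) →
      ∀ u : Euc N → ℝ, DiscSubsolFor lam Φ u →
        (Integrable Φ μ → lam * u z ≤ ∫ w, Φ w ∂μ)

open Metric Filter Topology
open scoped NNReal

/-! ### Locally Lipschitz functions -/

theorem LocallyLipschitz.ae_differentiableAt {N : ℕ} {u : Euc N → ℝ} (hu : LocallyLipschitz u) :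
    ∀ᵐ x : Euc N ∂volume, DifferentiableAt ℝ u x := by
  have key : ∀ n : ℕ, ∀ᵐ x : Euc N ∂volume, x ∈ closedBall (0 : Euc N) n →
      DifferentiableWithinAt ℝ u (closedBall 0 n) x := by
    intro n
    obtain ⟨C, hC⟩ := (hu.locallyLipschitzOn (s := closedBall (0 : Euc N) n)
      ).exists_lipschitzOnWith_of_compact (isCompact_closedBall _ _)
    exact hC.ae_differentiableWithinAt_of_mem
  filter_upwards [ae_all_iff.2 key] with x hx
  obtain ⟨n, hn⟩ := exists_nat_gt ‖x‖
  have hmem : closedBall (0 : Euc N) n ∈ 𝓝 x :=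
    mem_of_superset (isOpen_ball.mem_nhds (by simpa using hn)) ball_subset_closedBall
  exact (hx n (by simpa using hn.le)).differentiableAt hmem

/-- A null set meets almost every line of a given direction in a null set. -/
theorem ae_ae_add_smul {N : ℕ} {p : Euc N → Prop} (hp : ∀ᵐ x : Euc N ∂volume, p x) (w : Euc N) :
    ∀ᵐ z : Euc N ∂volume, ∀ᵐ t : ℝ ∂volume, p (z + t • w) := by
  obtain ⟨B, hpB, hBm, hB⟩ := exists_measurable_superset_of_null (ae_iff.1 hp)
  have hm : Measurable fun zt : Euc N × ℝ => zt.1 + zt.2 • w := by fun_prop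
  have hnull : (volume.prod volume : Measure (Euc N × ℝ))
      ((fun zt : Euc N × ℝ => zt.1 + zt.2 • w) ⁻¹' B) = 0 := by
    rw [Measure.prod_apply_symm (hm hBm)]
    refine (lintegral_congr fun t => ?_).trans (lintegral_zero)
    have : (fun z : Euc N => (z, t)) ⁻¹' ((fun zt : Euc N × ℝ => zt.1 + zt.2 • w) ⁻¹' B)
        = (fun z => z + t • w) ⁻¹' B := rfl
    rw [this, measure_preimage_add_right, hB]
  filter_upwards [Measure.measure_ae_null_of_prod_null hnull] with z hz
  rw [ae_iff]
  exact measure_mono_null (fun t ht => hpB ht) hz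

/-- A locally Lipschitz function whose gradient is bounded by `K` almost everywhere in a ball is
`K`-Lipschitz there. -/
theorem LocallyLipschitz.abs_sub_le_of_ae_norm_fderiv_le {N : ℕ} {u : Euc N → ℝ}
    (hu : LocallyLipschitz u) {r K : ℝ}
    (hK : ∀ᵐ x : Euc N ∂volume, x ∈ ball (0 : Euc N) r → ‖fderiv ℝ u x‖ ≤ K)
    {x y : Euc N} (hx : x ∈ ball (0 : Euc N) r) (hy : y ∈ ball (0 : Euc N) r) :
    |u y - u x| ≤ K * ‖y - x‖ := by
  set w := y - x with hw
  have hline : ∀ z, z ∈ ball (0 : Euc N) r → z + w ∈ ball (0 : Euc N) r →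
      (∀ᵐ t : ℝ ∂volume, DifferentiableAt ℝ u (z + t • w) ∧
        (z + t • w ∈ ball (0 : Euc N) r → ‖fderiv ℝ u (z + t • w)‖ ≤ K)) →
      |u (z + w) - u z| ≤ K * ‖w‖ := by
    intro z hz hzw hgood
    have hseg : ∀ t ∈ Icc (0 : ℝ) 1, z + t • w ∈ ball (0 : Euc N) r := by
      intro t ht
      have := (convex_ball (0 : Euc N) r).add_smul_sub_mem hz hzw ht
      simpa using this
    let f : ℝ → ℝ := fun t => u (z + t • w)
    have hac : AbsolutelyContinuousOnInterval f 0 1 := by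
      have hlip : LocallyLipschitz f := by
        have : LocallyLipschitz fun t : ℝ => z + t • w :=
          (ContDiff.locallyLipschitz (𝕂 := ℝ) (by fun_prop))
        exact hu.comp this
      obtain ⟨C, hC⟩ := (hlip.locallyLipschitzOn (s := uIcc (0 : ℝ) 1)
        ).exists_lipschitzOnWith_of_compact isCompact_uIcc
      exact hC.absolutelyContinuousOnInterval
    have hint := hac.integral_deriv_eq_sub
    have hbd : ‖∫ t in (0 : ℝ)..1, deriv f t‖ ≤ (K * ‖w‖) * |1 - 0| := by
      refine intervalIntegral.norm_integral_le_of_norm_le_const_ae ?_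
      filter_upwards [hgood] with t ht htI
      have htI' : t ∈ Icc (0 : ℝ) 1 := by
        rw [uIoc_of_le zero_le_one] at htI
        exact Ioc_subset_Icc_self htI
      have hl : HasDerivAt (fun t : ℝ => z + t • w) w t := by
        simpa using ((hasDerivAt_id t).smul_const w).const_add z
      have hd : HasDerivAt f (fderiv ℝ u (z + t • w) w) t :=
        ht.1.hasFDerivAt.comp_hasDerivAt t hl
      rw [hd.deriv]
      exact (ContinuousLinearMap.le_opNorm _ _).trans
        (mul_le_mul_of_nonneg_right (ht.2 (hseg t htI')) (norm_nonneg _))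
    rw [hint] at hbd
    simpa [f] using hbd
  by_contra! hcon
  have hcu := hu.continuous
  have hcw : Continuous fun z : Euc N => z + w := continuous_add_const w
  have hopen : IsOpen {z : Euc N | K * ‖w‖ < |u (z + w) - u z|} :=
    isOpen_lt continuous_const ((hcu.comp hcw).sub hcu).abs
  have hU := (isOpen_ball (x := (0 : Euc N)) (ε := r)).inter
    (((isOpen_ball (x := (0 : Euc N)) (ε := r)).preimage hcw).inter hopen)
  obtain ⟨z, hzU, hz⟩ := (Measure.dense_of_ae (ae_ae_add_smul
    (hu.ae_differentiableAt.and hK) w)).inter_open_nonempty _ hU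
    ⟨x, hx, by simpa [hw] using hy, by simpa [hw] using hcon⟩
  exact absurd (hline z hzU.1 hzU.2.1 hz) (not_le.2 hzU.2.2)

theorem fderiv_eq_of_le_of_eq {N : ℕ} {f g : Euc N → ℝ} {x : Euc N} (hle : ∀ᶠ y in 𝓝 x, f y ≤ g y)
    (heq : f x = g x) (hf : DifferentiableAt ℝ f x) (hg : DifferentiableAt ℝ g x) :
    fderiv ℝ f x = fderiv ℝ g x := by
  have hmin : IsLocalMin (fun y => g y - f y) x := by
    filter_upwards [hle] with y hy
    simp only [heq, sub_self]
    linarith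
  have := hmin.fderiv_eq_zero
  rw [fderiv_fun_sub hg hf, sub_eq_zero] at this
  exact this.symm

theorem inner_gradient {N : ℕ} (u : Euc N → ℝ) (x q : Euc N) :
    ⟪gradient u x, q⟫ = fderiv ℝ u x q := by
  rw [← InnerProductSpace.toDual_apply_apply (𝕜 := ℝ), toDual_gradient]

theorem norm_gradient {N : ℕ} (u : Euc N → ℝ) (x : Euc N) :
    ‖gradient u x‖ = ‖fderiv ℝ u x‖ := by
  rw [← toDual_gradient, LinearIsometryEquiv.norm_map]

theorem gradient_congr_fderiv {N : ℕ} {u v : Euc N → ℝ} {x : Euc N}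
    (h : fderiv ℝ u x = fderiv ℝ v x) : gradient u x = gradient v x := by
  rw [gradient, gradient, h]

/-! ### The Lagrangian -/

section Lagrangian

variable {N : ℕ} {H : Euc N × Euc N → ℝ}

theorem bddAbove_range_inner_sub (hc : Continuous H)
    (hsl : ∀ x : Euc N, ∀ C : ℝ, ∃ r : ℝ, ∀ p : Euc N, r ≤ ‖p‖ → C * ‖p‖ ≤ H (x, p))
    (z : Euc N × Euc N) :
    BddAbove (Set.range fun p : Euc N => ⟪p, z.2⟫ - H (z.1, p)) := by
  obtain ⟨r, hr⟩ := hsl z.1 ‖z.2‖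
  obtain ⟨B, hB⟩ := (isCompact_closedBall (0 : Euc N) r).bddAbove_image
    (f := fun p => ⟪p, z.2⟫ - H (z.1, p)) (by fun_prop)
  refine ⟨max B 0, ?_⟩
  rintro _ ⟨p, rfl⟩
  rcases le_total r ‖p‖ with h | h
  · refine le_max_of_le_right ?_
    have h1 := real_inner_le_norm p z.2
    have h2 := hr p h
    simp only
    nlinarith
  · exact le_max_of_le_left (hB ⟨p, by simpa using h, rfl⟩)

theorem inner_sub_le_Lag (hc : Continuous H)
    (hsl : ∀ x : Euc N, ∀ C : ℝ, ∃ r : ℝ, ∀ p : Euc N, r ≤ ‖p‖ → C * ‖p‖ ≤ H (x, p))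
    (x p q : Euc N) : ⟪p, q⟫ - H (x, p) ≤ Lag H (x, q) :=
  le_csSup (bddAbove_range_inner_sub hc hsl (x, q)) ⟨p, rfl⟩

theorem Lag_le {x q : Euc N} {b : ℝ} (h : ∀ p, ⟪p, q⟫ - H (x, p) ≤ b) : Lag H (x, q) ≤ b :=
  csSup_le (range_nonempty _) (by rintro _ ⟨p, rfl⟩; exact h p)

theorem sSup_image_closedBall_eq_Lag (hc : Continuous H)
    (hconv : ∀ x : Euc N, ConvexOn ℝ Set.univ fun p => H (x, p))
    (hsl : ∀ x : Euc N, ∀ C : ℝ, ∃ r : ℝ, ∀ p : Euc N, r ≤ ‖p‖ → C * ‖p‖ ≤ H (x, p))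
    {z : Euc N × Euc N} {ρ : ℝ} (hρ : 0 < ρ)
    (hz : ∀ p ∈ sphere (0 : Euc N) ρ, ⟪p, z.2⟫ - H (z.1, p) < - H (z.1, 0)) :
    sSup ((fun p => ⟪p, z.2⟫ - H (z.1, p)) '' closedBall (0 : Euc N) ρ) = Lag H z := by
  have hbdd := (bddAbove_range_inner_sub hc hsl z)
  have hbdd' : BddAbove ((fun p => ⟪p, z.2⟫ - H (z.1, p)) '' closedBall (0 : Euc N) ρ) :=
    hbdd.mono (image_subset_range _ _)
  refine le_antisymm (csSup_le_csSup hbdd ?_ (image_subset_range _ _)) ?_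
  · exact ⟨_, ⟨0, by simp; linarith, rfl⟩⟩
  refine csSup_le (range_nonempty _) ?_
  rintro _ ⟨p, rfl⟩
  rcases le_or_gt ‖p‖ ρ with h | h
  · exact le_csSup hbdd' ⟨p, by simpa using h, rfl⟩
  · have hp0 : 0 < ‖p‖ := by linarith
    have h0 : - H (z.1, 0) ≤
        sSup ((fun p => ⟪p, z.2⟫ - H (z.1, p)) '' closedBall (0 : Euc N) ρ) :=
      le_csSup hbdd' ⟨0, by simp; linarith, by simp⟩
    refine le_trans ?_ h0
    set θ : ℝ := ρ / ‖p‖ with hθ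
    have hθ0 : 0 < θ := by positivity
    have hθ1 : θ ≤ 1 := by rw [hθ, div_le_one hp0]; exact h.le
    have hs := hz (θ • p) (by
      rw [mem_sphere_iff_norm, sub_zero, norm_smul, Real.norm_eq_abs, abs_of_pos hθ0, hθ]
      field_simp)
    have hcv := (hconv z.1).2 (mem_univ p) (mem_univ (0 : Euc N)) hθ0.le
      (sub_nonneg.2 hθ1) (by ring)
    simp only [smul_zero, add_zero, smul_eq_mul] at hcv
    rw [real_inner_smul_left] at hs
    have : θ * (⟪p, z.2⟫ - H (z.1, p)) ≤ θ * (- H (z.1, 0)) := by linarith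
    exact le_of_mul_le_mul_left this hθ0

theorem continuous_Lag (hc : Continuous H)
    (hconv : ∀ x : Euc N, ConvexOn ℝ Set.univ fun p => H (x, p))
    (hsl : ∀ x : Euc N, ∀ C : ℝ, ∃ r : ℝ, ∀ p : Euc N, r ≤ ‖p‖ → C * ‖p‖ ≤ H (x, p)) :
    Continuous (Lag H) := by
  rw [continuous_iff_continuousAt]
  rintro ⟨x₀, q₀⟩
  obtain ⟨r, hr⟩ := hsl x₀ (‖q₀‖ + 1)
  set ρ : ℝ := max (max r 1) (H (x₀, 0) + 1) with hρ
  have hρ1 : 1 ≤ ρ := le_max_of_le_left (le_max_right _ _)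
  have hρr : r ≤ ρ := le_max_of_le_left (le_max_left _ _)
  have hρH : H (x₀, 0) + 1 ≤ ρ := le_max_right _ _
  have hev : ∀ᶠ z : Euc N × Euc N in 𝓝 (x₀, q₀), ∀ p ∈ sphere (0 : Euc N) ρ,
      ⟪p, z.2⟫ - H (z.1, p) < - H (z.1, 0) := by
    refine (isCompact_sphere (0 : Euc N) ρ).eventually_forall_of_forall_eventually ?_
    intro p hp
    have hp' : ‖p‖ = ρ := by simpa using hp
    have hlt : ⟪p, q₀⟫ - H (x₀, p) < - H (x₀, 0) := by
      have h1 := real_inner_le_norm p q₀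
      have h2 := hr p (by rw [hp']; exact hρr)
      rw [hp'] at h1 h2
      nlinarith
    have ho : IsOpen {w : (Euc N × Euc N) × Euc N |
        ⟪w.2, w.1.2⟫ - H (w.1.1, w.2) < - H (w.1.1, 0)} :=
      isOpen_lt (by fun_prop) (by fun_prop)
    exact ho.eventually_mem hlt
  have hloc : ∀ᶠ z : Euc N × Euc N in 𝓝 (x₀, q₀),
      sSup ((fun p => ⟪p, z.2⟫ - H (z.1, p)) '' closedBall (0 : Euc N) ρ) = Lag H z := by
    filter_upwards [hev] with z hz
    exact sSup_image_closedBall_eq_Lag hc hconv hsl (by linarith) hz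
  have hun : Continuous fun w : (Euc N × Euc N) × Euc N => ⟪w.2, w.1.2⟫ - H (w.1.1, w.2) := by
    fun_prop
  have hcont : Continuous fun z : Euc N × Euc N =>
      sSup ((fun p => ⟪p, z.2⟫ - H (z.1, p)) '' closedBall (0 : Euc N) ρ) :=
    (isCompact_closedBall (0 : Euc N) ρ).continuous_sSup
      (f := fun (z : Euc N × Euc N) (p : Euc N) => ⟪p, z.2⟫ - H (z.1, p)) hun
  exact hcont.continuousAt.congr hloc

/-- The Lagrangian grows superlinearly in the velocity, uniformly for positions in a ball. -/
theorem exists_mul_norm_sub_le_Lag (hc : Continuous H)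
    (hsl : ∀ x : Euc N, ∀ C : ℝ, ∃ r : ℝ, ∀ p : Euc N, r ≤ ‖p‖ → C * ‖p‖ ≤ H (x, p))
    (R : ℝ) {C : ℝ} (hC : 0 ≤ C) :
    ∃ B : ℝ, ∀ x q : Euc N, ‖x‖ ≤ R → C * ‖q‖ - B ≤ Lag H (x, q) := by
  obtain ⟨B, hB⟩ := ((isCompact_closedBall (0 : Euc N) R).prod
    (isCompact_closedBall (0 : Euc N) C)).bddAbove_image hc.continuousOn
  refine ⟨B, fun x q hx => ?_⟩
  set p : Euc N := (C / ‖q‖) • q with hp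
  have hpn : ‖p‖ ≤ C := by
    rcases eq_or_ne q 0 with rfl | hq
    · simpa [hp] using hC
    · have : 0 < ‖q‖ := norm_pos_iff.2 hq
      rw [hp, norm_smul, Real.norm_eq_abs, abs_of_nonneg (by positivity)]
      field_simp
      exact le_rfl
  have hpq : ⟪p, q⟫ = C * ‖q‖ := by
    rcases eq_or_ne q 0 with rfl | hq
    · simp
    · have : 0 < ‖q‖ := norm_pos_iff.2 hq
      rw [hp, real_inner_smul_left, real_inner_self_eq_norm_sq]
      field_simp
  have hH : H (x, p) ≤ B := hB ⟨(x, p), ⟨by simpa using hx, by simpa using hpn⟩, rfl⟩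
  have := inner_sub_le_Lag hc hsl x p q
  linarith

/-- A convex Hamiltonian is the supremum of its affine minorants. -/
theorem exists_inner_add_le (hc : Continuous H)
    (hconv : ∀ x : Euc N, ConvexOn ℝ Set.univ fun p => H (x, p)) {x p : Euc N} {s : ℝ}
    (hs : s < H (x, p)) :
    ∃ (q : Euc N) (b : ℝ), (∀ p', ⟪p', q⟫ + b ≤ H (x, p')) ∧ ⟪p, q⟫ + b = s := by
  obtain ⟨l, b, hl, hlp⟩ := ConvexOn.exists_affine_le_of_lt (𝕜 := ℝ) (s := univ)
    (φ := fun p => H (x, p)) (mem_univ p) hs isClosed_univ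
    ((hc.comp (Continuous.prodMk_right x)).lowerSemicontinuous.lowerSemicontinuousOn _) (hconv x)
  refine ⟨(InnerProductSpace.toDual ℝ (Euc N)).symm l, b, fun p' => ?_, ?_⟩
  · rw [real_inner_comm, InnerProductSpace.toDual_symm_apply]
    simpa using hl ⟨p', mem_univ _⟩
  · rw [real_inner_comm, InnerProductSpace.toDual_symm_apply]
    simpa using hlp

/-- Over a ball of positions, sublevels of `H` are determined by the values of the Lagrangian on a
bounded set of velocities. -/
theorem exists_forall_le_of_inner_le_Lag (hc : Continuous H)
    (hconv : ∀ x : Euc N, ConvexOn ℝ Set.univ fun p => H (x, p))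
    (hcoer : ∀ R : ℝ, 0 < R → ∀ C : ℝ, ∃ r : ℝ, ∀ x p : Euc N,
      ‖x‖ ≤ R → r ≤ ‖p‖ → C ≤ H (x, p))
    (hsl : ∀ x : Euc N, ∀ C : ℝ, ∃ r : ℝ, ∀ p : Euc N, r ≤ ‖p‖ → C * ‖p‖ ≤ H (x, p))
    {R : ℝ} (hR : 0 < R) :
    ∃ r : ℝ, 0 ≤ r ∧ ∀ x p : Euc N, ‖x‖ ≤ R → ∀ a ≤ 0,
      (∀ q : Euc N, ‖q‖ ≤ r → ⟪p, q⟫ ≤ Lag H (x, q) + a) → H (x, p) ≤ a := by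
  obtain ⟨A, hA⟩ := (isCompact_closedBall (0 : Euc N) R).bddAbove_image
    (f := fun x => H (x, 0)) (by fun_prop)
  set A' : ℝ := max A 0 with hA'
  have hHA : ∀ x : Euc N, ‖x‖ ≤ R → H (x, 0) ≤ A' := fun x hx =>
    le_max_of_le_left (hA ⟨x, by simpa using hx, rfl⟩)
  obtain ⟨ρ₀, hρ₀⟩ := hcoer R hR (A' + 1)
  set ρ : ℝ := max ρ₀ 0 with hρ
  have hρ0 : 0 ≤ ρ := le_max_right _ _
  obtain ⟨B, hB⟩ := ((isCompact_closedBall (0 : Euc N) R).prod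
    (isCompact_closedBall (0 : Euc N) (ρ + 1))).exists_bound_of_continuousOn hc.continuousOn
  have hB' : ∀ x p : Euc N, ‖x‖ ≤ R → ‖p‖ ≤ ρ + 1 → |H (x, p)| ≤ B := fun x p hx hp =>
    hB (x, p) ⟨by simpa using hx, by simpa using hp⟩
  have hB0 : 0 ≤ B := (abs_nonneg _).trans (hB' 0 0 (by simpa using hR.le) (by simp; linarith))
  have key : ∀ x p : Euc N, ‖x‖ ≤ R → ‖p‖ ≤ ρ → ∀ a : ℝ,
      (∀ q : Euc N, ‖q‖ ≤ 2 * B + 1 → ⟪p, q⟫ ≤ Lag H (x, q) + a) → H (x, p) ≤ a := by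
    intro x p hx hp a h
    by_contra! hlt
    obtain ⟨s, hs1, hs2⟩ := exists_between (max_lt hlt (sub_one_lt (H (x, p))))
    have has : a < s := (le_max_left _ _).trans_lt hs1
    have hHs : H (x, p) - 1 < s := (le_max_right _ _).trans_lt hs1
    obtain ⟨q, b, hq, hpq⟩ := exists_inner_add_le hc hconv hs2
    have hqn : ‖q‖ ≤ 2 * B + 1 := by
      rcases eq_or_ne q 0 with rfl | hq0
      · simp; linarith
      have hpos : 0 < ‖q‖ := norm_pos_iff.2 hq0
      have hun : ‖‖q‖⁻¹ • q‖ = 1 := by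
        rw [norm_smul, norm_inv, norm_norm, inv_mul_cancel₀ hpos.ne']
      have h1 := hq (p + ‖q‖⁻¹ • q)
      rw [inner_add_left, real_inner_smul_left, real_inner_self_eq_norm_sq] at h1
      have h2 : ‖q‖⁻¹ * ‖q‖ ^ 2 = ‖q‖ := by field_simp
      have h3 := hB' x (p + ‖q‖⁻¹ • q) hx ((norm_add_le _ _).trans (by rw [hun]; linarith))
      have h4 := hB' x p hx (by linarith)
      rw [abs_le] at h3 h4
      linarith [h3.2, h4.1]
    have hL : Lag H (x, q) ≤ -b := Lag_le fun p' => by linarith [hq p']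
    linarith [h q hqn]
  refine ⟨2 * B + 1, by linarith, fun x p hx a ha h => ?_⟩
  rcases le_or_gt ‖p‖ ρ with hp | hp
  · exact key x p hx hp a h
  exfalso
  have hp0 : 0 < ‖p‖ := by linarith
  set θ : ℝ := ρ / ‖p‖ with hθ
  have hθ0 : 0 ≤ θ := by positivity
  have hθ1 : θ ≤ 1 := by rw [hθ, div_le_one hp0]; exact hp.le
  have hnorm : ‖θ • p‖ = ρ := by
    rw [norm_smul, Real.norm_eq_abs, abs_of_nonneg hθ0, hθ]
    field_simp
  have h1 := key x (θ • p) hx hnorm.le A' fun q hq => by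
    have h2 := h q hq
    have h3 := inner_sub_le_Lag hc hsl x 0 q
    rw [inner_zero_left, zero_sub] at h3
    rw [real_inner_smul_left]
    have hA0 : 0 ≤ A' := le_max_right _ _
    have h4 := hHA x hx
    nlinarith
  have h2 := hρ₀ x (θ • p) hx (by rw [hnorm]; exact le_max_left _ _)
  linarith

end Lagrangian

/-! ### Subsolutions -/

section Subsolutions

variable {N : ℕ} {H : Euc N × Euc N → ℝ}

/-- A subsolution in a large ball can be modified outside a smaller ball into a global subsolution
which is strict at infinity. -/
theorem exists_isSubsol_of_abs_le {R ε m M a : ℝ} (hε : 0 < ε) (hM : 0 ≤ M)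
    (hH : ∀ x : Euc N, R ≤ ‖x‖ → ∀ p : Euc N, ‖p‖ ≤ ε → H (x, p) ≤ m) (hma : m ≤ a)
    {u : Euc N → ℝ} (hu : LocallyLipschitz u) (huM : ∀ x : Euc N, ‖x‖ ≤ R → |u x| ≤ M)
    (hua : ∀ᵐ x : Euc N ∂volume, ‖x‖ < R + 2 * M / ε → DifferentiableAt ℝ u x →
      H (x, gradient u x) ≤ a) :
    ∃ v, IsSubsol H a v ∧ ∀ᵐ x : Euc N ∂volume, R + 2 * M / ε ≤ ‖x‖ →
      DifferentiableAt ℝ v x → H (x, gradient v x) ≤ m := by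
  let g : Euc N → ℝ := fun x => -M + ε * (‖x‖ - R)
  have hglip : LipschitzWith ε.toNNReal g := by
    refine LipschitzWith.of_dist_le_mul fun x y => ?_
    rw [Real.coe_toNNReal _ hε.le, Real.dist_eq, dist_eq_norm]
    have : g x - g y = ε * (‖x‖ - ‖y‖) := by simp only [g]; ring
    rw [this, abs_mul, abs_of_pos hε]
    exact mul_le_mul_of_nonneg_left (abs_norm_sub_norm_le x y) hε.le
  have hgd : ∀ x, ‖fderiv ℝ g x‖ ≤ ε := fun x => by
    simpa [hε.le] using norm_fderiv_le_of_lipschitz ℝ hglip (x₀ := x)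
  let v : Euc N → ℝ := fun x => max (min (u x) M) (g x)
  have hvlip : LocallyLipschitz v := (hu.min_const M).max hglip.locallyLipschitz
  have hvg : ∀ x, R ≤ ‖x‖ → DifferentiableAt ℝ v x → DifferentiableAt ℝ g x → v x = g x →
      H (x, gradient v x) ≤ m := by
    intro x hx hdv hdg hxe
    have := fderiv_eq_of_le_of_eq (f := g) (g := v) (.of_forall fun y => le_max_right _ _)
      hxe.symm hdg hdv
    rw [← gradient_congr_fderiv this]
    exact hH x hx _ (by rw [norm_gradient]; exact hgd x)
  refine ⟨v, ⟨hvlip, ?_⟩, ?_⟩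
  · filter_upwards [hu.ae_differentiableAt, hglip.locallyLipschitz.ae_differentiableAt,
      (hu.min_const M).ae_differentiableAt, hua] with x hdu hdg hdm hxa hdv
    by_cases hgx : min (u x) M < g x
    · have hRx : R ≤ ‖x‖ := by
        by_contra! hlt
        have h1 := neg_le_of_abs_le (huM x hlt.le)
        have h2 : -M ≤ min (u x) M := le_min h1 (by linarith)
        have h3 : g x ≤ -M := by simp only [g]; nlinarith
        linarith
      exact (hvg x hRx hdv hdg (max_eq_right hgx.le)).trans hma
    · have hvx : v x = min (u x) M := max_eq_left (not_lt.1 hgx)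
      have hmv := fderiv_eq_of_le_of_eq (f := fun x => min (u x) M) (g := v)
        (.of_forall fun y => le_max_left _ _) hvx.symm hdm hdv
      rw [← gradient_congr_fderiv hmv]
      rcases le_or_gt M (u x) with hux | hux
      · have hmc := fderiv_eq_of_le_of_eq (f := fun x => min (u x) M) (g := fun _ => M)
          (.of_forall fun y => min_le_right _ _) (min_eq_right hux) hdm
          (differentiableAt_const _)
        rcases le_or_gt R ‖x‖ with hRx | hRx
        · refine (hH x hRx _ ?_).trans hma
          rw [norm_gradient, hmc]
          simpa using hε.le
        · have hue : u x = M := le_antisymm ((le_abs_self _).trans (huM x hRx.le)) hux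
          have hmu := fderiv_eq_of_le_of_eq (f := fun x => min (u x) M) (g := u)
            (.of_forall fun y => min_le_left _ _) (by simp [hue]) hdm hdu
          rw [gradient_congr_fderiv hmu]
          exact hxa (hRx.trans_le (le_add_of_nonneg_right (by positivity))) hdu
      · have hmu := fderiv_eq_of_le_of_eq (f := fun x => min (u x) M) (g := u)
          (.of_forall fun y => min_le_left _ _) (min_eq_left hux.le) hdm hdu
        rw [gradient_congr_fderiv hmu]
        refine hxa ?_ hdu
        by_contra! hge
        have h1 : M ≤ g x := by
          have : ε * (2 * M / ε) ≤ ε * (‖x‖ - R) :=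
            mul_le_mul_of_nonneg_left (by linarith) hε.le
          rw [mul_div_cancel₀ _ hε.ne'] at this
          simp only [g]; linarith
        exact hgx ((min_le_left _ _).trans_lt (hux.trans_le h1))
  · filter_upwards [hglip.locallyLipschitz.ae_differentiableAt] with x hdg hx hdv
    refine hvg x (le_trans (le_add_of_nonneg_right (by positivity)) hx) hdv hdg ?_
    refine max_eq_right ((min_le_right _ _).trans ?_)
    have : ε * (2 * M / ε) ≤ ε * (‖x‖ - R) := mul_le_mul_of_nonneg_left (by linarith) hε.le
    rw [mul_div_cancel₀ _ hε.ne'] at this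
    simp only [g]; linarith

theorem LocallyLipschitz.sub_const {u : Euc N → ℝ} (hu : LocallyLipschitz u) (c : ℝ) :
    LocallyLipschitz fun x => u x - c :=
  ((LipschitzWith.id.sub (LipschitzWith.const c)).locallyLipschitz (f := fun t : ℝ => t - c)).comp hu

/-- The radius beyond which subsolutions of level at most `1` can be made strict. -/
theorem exists_radius_isSubsol
    (hcoer : ∀ R : ℝ, 0 < R → ∀ C : ℝ, ∃ r : ℝ, ∀ x p : Euc N,
      ‖x‖ ≤ R → r ≤ ‖p‖ → C ≤ H (x, p))
    {R ε m : ℝ} (hε : 0 < ε)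
    (hH : ∀ x : Euc N, R ≤ ‖x‖ → ∀ p : Euc N, ‖p‖ ≤ ε → H (x, p) ≤ m) :
    ∃ R' > (0 : ℝ), ∀ a, m ≤ a → a ≤ 1 → ∀ u : Euc N → ℝ, LocallyLipschitz u →
      (∀ᵐ x : Euc N ∂volume, ‖x‖ < R' → DifferentiableAt ℝ u x → H (x, gradient u x) ≤ a) →
      ∃ v, IsSubsol H a v ∧ ∀ᵐ x : Euc N ∂volume, R' ≤ ‖x‖ →
        DifferentiableAt ℝ v x → H (x, gradient v x) ≤ m := by
  set R₁ : ℝ := max R 1 with hR₁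
  have hR₁0 : 0 < R₁ := lt_of_lt_of_le one_pos (le_max_right _ _)
  obtain ⟨K₀, hK₀⟩ := hcoer (R₁ + 1) (by linarith) 2
  set K : ℝ := max K₀ 0 with hK
  have hK0 : 0 ≤ K := le_max_right _ _
  set M : ℝ := K * R₁ + ε with hM
  have hM0 : 0 ≤ M := by positivity
  have hMε : 1 ≤ 2 * M / ε := by
    rw [le_div_iff₀ hε]
    nlinarith [mul_nonneg hK0 hR₁0.le]
  refine ⟨R₁ + 2 * M / ε, by linarith, fun a hma ha1 u hu hua => ?_⟩
  have hbound : ∀ᵐ x : Euc N ∂volume, x ∈ ball (0 : Euc N) (R₁ + 1) → ‖fderiv ℝ u x‖ ≤ K := by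
    filter_upwards [hua, hu.ae_differentiableAt] with x hx hd hxb
    rw [mem_ball_zero_iff] at hxb
    have h1 := hx (by linarith) hd
    by_contra! hlt
    have h2 := hK₀ x (gradient u x) hxb.le
      ((le_max_left _ _).trans (by rw [norm_gradient]; exact hlt.le))
    linarith
  refine exists_isSubsol_of_abs_le (u := fun x => u x - u 0) hε hM0
    (fun x hx => hH x ((le_max_left _ _).trans hx)) hma (hu.sub_const _) (fun x hx => ?_) ?_
  · have h := hu.abs_sub_le_of_ae_norm_fderiv_le hbound (x := 0) (y := x)
      (by simp; linarith) (by simp; linarith)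
    rw [sub_zero] at h
    refine h.trans ?_
    have := mul_le_mul_of_nonneg_left hx hK0
    linarith
  · filter_upwards [hua, hu.ae_differentiableAt] with x hx hd hxR _
    have : gradient (fun x => u x - u 0) x = gradient u x :=
      gradient_congr_fderiv (fderiv_sub_const (u 0))
    rw [this]
    exact hx hxR hd

/-- The strict inequality at infinity forces `m` to lie below the critical value. -/
theorem lt_zero_and_critical (hc : Continuous H)
    (hcoer : ∀ R : ℝ, 0 < R → ∀ C : ℝ, ∃ r : ℝ, ∀ x p : Euc N,
      ‖x‖ ≤ R → r ≤ ‖p‖ → C ≤ H (x, p))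
    {R ε m : ℝ} (hε : 0 < ε)
    (hH : ∀ x : Euc N, R ≤ ‖x‖ → ∀ p : Euc N, ‖p‖ ≤ ε → H (x, p) ≤ m)
    {x₀ : Euc N} (hx₀ : ∀ p : Euc N, m < H (x₀, p))
    (hcrit : sInf {a : ℝ | ∃ u : Euc N → ℝ, IsSubsol H a u} = 0) :
    m < 0 ∧ (∀ a u, IsSubsol H a u → 0 ≤ a) ∧
      ∀ c > (0 : ℝ), ∃ a, 0 ≤ a ∧ a < c ∧ ∃ u, IsSubsol H a u := by
  obtain ⟨r, hr⟩ := hcoer (‖x₀‖ + 1) (by positivity) (m + 1)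
  obtain ⟨η, hη0, hη1, hη⟩ : ∃ η > (0 : ℝ), η ≤ 1 ∧ ∀ p ∈ closedBall (0 : Euc N) r,
      m + η < H (x₀, p) := by
    rcases (closedBall (0 : Euc N) r).eq_empty_or_nonempty with he | hne
    · exact ⟨1, one_pos, le_rfl, by simp [he]⟩
    obtain ⟨p₀, -, hp₀⟩ := (isCompact_closedBall (0 : Euc N) r).exists_isMinOn hne
      (f := fun p => H (x₀, p)) (by fun_prop)
    refine ⟨min 1 ((H (x₀, p₀) - m) / 2), lt_min one_pos (by linarith [hx₀ p₀]),
      min_le_left _ _, fun p hp => ?_⟩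
    have h1 : H (x₀, p₀) ≤ H (x₀, p) := hp₀ hp
    have h2 := min_le_right 1 ((H (x₀, p₀) - m) / 2)
    linarith [hx₀ p₀]
  have hopen : IsOpen {w : Euc N × Euc N | m + η < H w} := isOpen_lt continuous_const hc
  have hev : ∀ᶠ x in 𝓝 x₀, ∀ p ∈ closedBall (0 : Euc N) r, m + η < H (x, p) :=
    (isCompact_closedBall (0 : Euc N) r).eventually_forall_of_forall_eventually
      fun p hp => hopen.eventually_mem (hη p hp)
  have hlow : ∀ a u, IsSubsol H a u → m + η ≤ a := by
    rintro a u ⟨hu, hua⟩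
    have hev' := hev.and (ball_mem_nhds x₀ one_pos)
    obtain ⟨U, hUsub, hUo, hxU⟩ := _root_.mem_nhds_iff.1 hev'
    obtain ⟨x, hxUm, hx⟩ := (Measure.dense_of_ae
      (hu.ae_differentiableAt.and hua)).inter_open_nonempty U hUo ⟨x₀, hxU⟩
    obtain ⟨h1, h2⟩ := hUsub hxUm
    have h3 := hx.2 hx.1
    rcases le_total r ‖gradient u x‖ with h | h
    · have hxn : ‖x‖ ≤ ‖x₀‖ + 1 := by
        have h4 := norm_le_norm_add_norm_sub' x x₀
        rw [← dist_eq_norm] at h4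
        linarith
      linarith [hr x _ hxn h]
    · linarith [h1 _ (by simpa using h)]
  have hbdd : BddBelow {a : ℝ | ∃ u : Euc N → ℝ, IsSubsol H a u} :=
    ⟨m + η, fun a ⟨u, hu⟩ => hlow a u hu⟩
  have hne : {a : ℝ | ∃ u : Euc N → ℝ, IsSubsol H a u}.Nonempty := by
    obtain ⟨A, hA⟩ := (isCompact_closedBall (0 : Euc N) R).bddAbove_image
      (f := fun x => H (x, 0)) (by fun_prop)
    refine ⟨max A m, fun _ => 0, LocallyLipschitz.const 0, .of_forall fun x _ => ?_⟩
    have h0 : gradient (fun _ : Euc N => (0 : ℝ)) x = 0 := by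
      rw [← norm_eq_zero, norm_gradient]
      simp
    rw [h0]
    rcases le_total R ‖x‖ with h | h
    · exact le_max_of_le_right (hH x h 0 (by simpa using hε.le))
    · exact le_max_of_le_left (hA ⟨x, by simpa using h, rfl⟩)
  have hnonneg : ∀ a u, IsSubsol H a u → 0 ≤ a := fun a u hu => by
    rw [← hcrit]
    exact csInf_le hbdd ⟨u, hu⟩
  refine ⟨?_, hnonneg, fun c hcpos => ?_⟩
  · have : m + η ≤ 0 := by
      rw [← hcrit]
      exact le_csInf hne fun a ⟨u, hu⟩ => hlow a u hu
    linarith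
  · obtain ⟨a, ⟨u, hu⟩, hac⟩ := exists_lt_of_csInf_lt hne (hcrit.trans_lt hcpos)
    exact ⟨a, hnonneg a u hu, hac, u, hu⟩

end Subsolutions

/-! ### Measures that are nonnegative on a cone of functions -/

/-- If no member of a convex cone of continuous functions on a compact space is everywhere negative,
then some probability measure gives a nonnegative integral to every member of the cone. -/
theorem exists_probabilityMeasure_integral_nonneg {X : Type*} [TopologicalSpace X] [T2Space X]
    [CompactSpace X] [Nonempty X] [MeasurableSpace X] [BorelSpace X] {G : Set C(X, ℝ)}
    (hG0 : (0 : C(X, ℝ)) ∈ G) (hGc : Convex ℝ G)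
    (hGs : ∀ g ∈ G, ∀ t : ℝ, 0 ≤ t → t • g ∈ G) (hGn : ∀ g ∈ G, ∃ x, 0 ≤ g x) :
    ∃ ν : ProbabilityMeasure X, ∀ g ∈ G, 0 ≤ ∫ x, g x ∂(ν : Measure X) := by
  have hopen : IsOpen {f : C(X, ℝ) | MapsTo f univ (Iio 0)} :=
    ContinuousMap.isOpen_setOfPred_mapsTo isCompact_univ isOpen_Iio
  have hconv : Convex ℝ {f : C(X, ℝ) | MapsTo f univ (Iio 0)} := by
    intro f hf g hg a b ha hb hab x hx
    have h1 : f x < 0 := hf hx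
    have h2 : g x < 0 := hg hx
    change a * f x + b * g x < 0
    rcases ha.eq_or_lt with rfl | ha
    · have : b = 1 := by linarith
      subst this; linarith
    · nlinarith [mul_neg_of_pos_of_neg ha h1]
  have hdisj : Disjoint {f : C(X, ℝ) | MapsTo f univ (Iio 0)} G := by
    rw [Set.disjoint_left]
    intro f hf hfG
    obtain ⟨x, hx⟩ := hGn f hfG
    exact absurd (hf (mem_univ x)) (not_lt.2 hx)
  obtain ⟨ℓ, t, hneg, hpos⟩ := geometric_hahn_banach_open hconv hopen hGc hdisj
  have ht : t ≤ 0 := by simpa using hpos 0 hG0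
  have hℓneg : ∀ f : C(X, ℝ), (∀ x, f x < 0) → ℓ f < 0 := fun f hf =>
    (hneg f fun x _ => hf x).trans_le ht
  have hℓG : ∀ g ∈ G, 0 ≤ ℓ g := by
    intro g hg
    by_contra! hlt
    have h := hpos _ (hGs g hg ((t - 1) / ℓ g) (div_nonneg_of_nonpos (by linarith) hlt.le))
    rw [map_smul, smul_eq_mul, div_mul_cancel₀ _ hlt.ne] at h
    linarith
  have hℓ1 : 0 < ℓ 1 := by
    have := hℓneg (-1) (by simp)
    rw [map_neg] at this
    linarith
  have hℓmono : ∀ f g : C(X, ℝ), (∀ x, f x ≤ g x) → ℓ f ≤ ℓ g := by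
    intro f g hfg
    refine le_of_forall_pos_le_add fun η hη => ?_
    have h := hℓneg (f - g - (η / ℓ 1) • 1) fun x => by
      have := hfg x
      have : 0 < η / ℓ 1 := by positivity
      simp only [ContinuousMap.coe_sub, ContinuousMap.coe_smul, ContinuousMap.coe_one,
        Pi.sub_apply, Pi.smul_apply, Pi.one_apply, smul_eq_mul, mul_one]
      linarith
    rw [map_sub, map_sub, map_smul, smul_eq_mul, div_mul_cancel₀ _ hℓ1.ne'] at h
    linarith
  let Λ : CompactlySupportedContinuousMap X ℝ →ₚ[ℝ] ℝ :=
    { toFun f := ℓ f.toContinuousMap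
      map_add' f g := ℓ.map_add f.toContinuousMap g.toContinuousMap
      map_smul' c f := ℓ.map_smul c f.toContinuousMap
      monotone' f g hfg := hℓmono _ _ hfg }
  let ρ := RealRMK.rieszMeasure Λ
  have hρ : ∀ f : C(X, ℝ), ∫ x, f x ∂ρ = ℓ f := fun f =>
    RealRMK.integral_rieszMeasure Λ
      { toContinuousMap := f, hasCompactSupport' := HasCompactSupport.of_compactSpace _ }
  have hρreal : ρ.real univ = ℓ 1 := by
    rw [← hρ 1]
    simp
  have hρne : ρ ≠ 0 := by
    intro h
    rw [h] at hρreal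
    simp at hρreal
    linarith
  have hfin : IsFiniteMeasure ρ := inferInstance
  have : NeZero ρ := ⟨hρne⟩
  refine ⟨⟨(ρ univ)⁻¹ • ρ, isProbabilityMeasureSMul⟩, fun g hg => ?_⟩
  change 0 ≤ ∫ x, g x ∂((ρ univ)⁻¹ • ρ)
  rw [integral_smul_measure, hρ]
  exact smul_nonneg ENNReal.toReal_nonneg (hℓG g hg)

/-! ### Mather measures -/

section Mather

variable {N : ℕ} {H : Euc N × Euc N → ℝ}

theorem fderiv_le_Lag_add (hFY : ∀ x p q : Euc N, ⟪p, q⟫ - H (x, p) ≤ Lag H (x, q))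
    (v : Euc N → ℝ) (x q : Euc N) :
    fderiv ℝ v x q ≤ Lag H (x, q) + H (x, gradient v x) := by
  rw [← inner_gradient]
  linarith [hFY x (gradient v x) q]

/-- Mather measures do not charge the region where subsolutions can be made strict. -/
theorem MatherMeasure.ae_norm_fst_le {μ : Measure (Euc N × Euc N)} (hμ : MatherMeasure H μ)
    (hLc : Continuous (Lag H)) {A : ℝ} (hA : ∀ z, A ≤ Lag H z)
    (hFY : ∀ x p q : Euc N, ⟪p, q⟫ - H (x, p) ≤ Lag H (x, q)) {m R : ℝ} (hm : m < 0)
    (hv : ∀ c > (0 : ℝ), c ≤ 1 → ∃ v, IsSubsol H c v ∧ ∀ᵐ x : Euc N ∂volume, R ≤ ‖x‖ →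
        DifferentiableAt ℝ v x → H (x, gradient v x) ≤ m) :
    ∀ᵐ z ∂μ, ‖z.1‖ ≤ R := by
  obtain ⟨hprob, hLi, hL0, hΦ⟩ := hμ
  let χ : Euc N × Euc N → ℝ := fun z => min 1 (max 0 (‖z.1‖ - R))
  have hχc : Continuous χ := by fun_prop
  have hχ0 : ∀ z, 0 ≤ χ z := fun z => le_min zero_le_one (le_max_left _ _)
  have hχ1 : ∀ z, χ z ≤ 1 := fun z => min_le_left _ _
  have hχi : Integrable χ μ := (integrable_const (1 : ℝ)).mono' hχc.aestronglyMeasurable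
    (.of_forall fun z => by rw [Real.norm_eq_abs, abs_of_nonneg (hχ0 z)]; exact hχ1 z)
  have hχint : 0 ≤ ∫ z, χ z ∂μ := integral_nonneg hχ0
  have hbound : ∀ c > (0 : ℝ), c ≤ 1 → -m * ∫ z, χ z ∂μ ≤ c := by
    intro c hc0 hc1
    obtain ⟨v, ⟨hvl, hva⟩, hvm⟩ := hv c hc0 hc1
    have hsub : SubsolFor (fun z => Lag H z + c - (c - m) * χ z) v := by
      refine ⟨hvl, ?_⟩
      filter_upwards [hva, hvm] with x hxa hxm hd q
      have h1 := fderiv_le_Lag_add hFY v x q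
      rcases le_total R ‖x‖ with hx | hx
      · have h2 := hxm hx hd
        have h3 : (c - m) * χ (x, q) ≤ (c - m) * 1 :=
          mul_le_mul_of_nonneg_left (hχ1 _) (by linarith)
        linarith
      · have h2 := hxa hd
        have h3 : χ (x, q) = 0 := by
          simp only [χ]
          rw [max_eq_left (by linarith), min_eq_right zero_le_one]
        rw [h3]
        linarith
    have hLci : Integrable (fun z => Lag H z + c) μ := hLi.add (integrable_const c)
    have hint : Integrable (fun z => Lag H z + c - (c - m) * χ z) μ :=
      hLci.sub (hχi.const_mul _)
    have h := hΦ _ (by fun_prop) ⟨A + m, by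
      rintro _ ⟨z, rfl⟩
      have h3 : (c - m) * χ z ≤ (c - m) * 1 :=
        mul_le_mul_of_nonneg_left (hχ1 _) (by linarith)
      have := hA z
      simp only
      linarith⟩ ⟨v, hsub⟩ hint
    rw [integral_sub hLci (hχi.const_mul _),
      integral_add hLi (integrable_const c), hL0, integral_const_mul] at h
    simp only [integral_const, probReal_univ, one_smul, zero_add] at h
    nlinarith
  have hzero : ∫ z, χ z ∂μ = 0 := by
    refine le_antisymm ?_ hχint
    have : -m * ∫ z, χ z ∂μ ≤ 0 := le_of_forall_pos_le_add fun η hη => by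
      have := hbound (min η 1) (lt_min hη one_pos) (min_le_right _ _)
      linarith [min_le_left η 1]
    nlinarith
  filter_upwards [(integral_eq_zero_iff_of_nonneg hχ0 hχi).1 hzero] with z hz
  by_contra! hlt
  have : 0 < χ z := lt_min one_pos (lt_max_of_lt_right (by linarith))
  exact this.ne' hz

/-- On a ball of positions, Mather measures live where the Lagrangian grows at most linearly. -/
theorem MatherMeasure.ae_Lag_le {μ : Measure (Euc N × Euc N)} (hμ : MatherMeasure H μ)
    (hLc : Continuous (Lag H)) {A : ℝ} (hA : ∀ z, A ≤ Lag H z)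
    (hFY : ∀ x p q : Euc N, ⟪p, q⟫ - H (x, p) ≤ Lag H (x, q))
    (hv : ∀ c > (0 : ℝ), c ≤ 1 → ∃ v, IsSubsol H c v) {R K : ℝ} (hK0 : 0 ≤ K)
    (hK : ∀ x p : Euc N, ‖x‖ ≤ R + 1 → K ≤ ‖p‖ → 2 ≤ H (x, p)) :
    ∀ᵐ z ∂μ, ‖z.1‖ ≤ R → Lag H z ≤ K * ‖z.2‖ := by
  obtain ⟨hprob, hLi, hL0, hΦ⟩ := hμ
  let ψ : Euc N × Euc N → ℝ := fun z => min 1 (max 0 (R + 1 - ‖z.1‖))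
  have hψ0 : ∀ z, 0 ≤ ψ z := fun z => le_min zero_le_one (le_max_left _ _)
  have hψ1 : ∀ z, ψ z ≤ 1 := fun z => min_le_left _ _
  let f : ℝ → Euc N × Euc N → ℝ := fun c z => ψ z * max 0 (Lag H z + c - K * ‖z.2‖)
  have hfc : ∀ c, Continuous (f c) := fun c => by fun_prop
  have hf0 : ∀ c z, 0 ≤ f c z := fun c z => mul_nonneg (hψ0 z) (le_max_left _ _)
  have hfle : ∀ c z, f c z ≤ max 0 (Lag H z + c - K * ‖z.2‖) := fun c z =>
    mul_le_of_le_one_left (le_max_left _ _) (hψ1 z)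
  have hfi : ∀ c, 0 ≤ c → Integrable (f c) μ := fun c hc0 =>
    (hLi.norm.add (integrable_const c)).mono' (hfc c).aestronglyMeasurable
      (.of_forall fun z => by
        rw [Real.norm_eq_abs, abs_of_nonneg (hf0 c z)]
        refine (hfle c z).trans (max_le ?_ ?_)
        · simp only [Pi.add_apply]; positivity
        · have h1 : Lag H z ≤ ‖Lag H z‖ := le_abs_self _
          have h2 : 0 ≤ K * ‖z.2‖ := by positivity
          simp only [Pi.add_apply]
          linarith)
  have hbound : ∀ c > (0 : ℝ), c ≤ 1 → ∫ z, f 0 z ∂μ ≤ c := by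
    intro c hc0 hc1
    obtain ⟨v, hvl, hva⟩ := hv c hc0 hc1
    have hsub : SubsolFor (fun z => Lag H z + c - f c z) v := by
      refine ⟨hvl, ?_⟩
      filter_upwards [hva] with x hxa hd q
      have h1 := fderiv_le_Lag_add hFY v x q
      have h2 := hxa hd
      rcases le_total (R + 1) ‖x‖ with hx | hx
      · have h3 : f c (x, q) = 0 := by
          simp only [f, ψ]
          rw [max_eq_left (a := (0 : ℝ)) (by linarith), min_eq_right zero_le_one, zero_mul]
        rw [h3]
        linarith
      · have h3 : ‖gradient v x‖ ≤ K := by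
          by_contra! hlt
          linarith [hK x _ hx hlt.le]
        have h4 : fderiv ℝ v x q ≤ K * ‖q‖ := by
          rw [← inner_gradient]
          exact (real_inner_le_norm _ _).trans (mul_le_mul_of_nonneg_right h3 (norm_nonneg _))
        have h5 := hfle c (x, q)
        rcases max_cases 0 (Lag H (x, q) + c - K * ‖(x, q).2‖) with h6 | h6
        · linarith
        · simp only at h6 h5 ⊢
          linarith
    have hLci : Integrable (fun z => Lag H z + c) μ := hLi.add (integrable_const c)
    have hint : Integrable (fun z => Lag H z + c - f c z) μ :=
      hLci.sub (hfi c hc0.le)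
    have h := hΦ _ (by fun_prop) ⟨min A 0, by
      rintro _ ⟨z, rfl⟩
      have h1 := hfle c z
      have h2 := hA z
      have h3 : 0 ≤ K * ‖z.2‖ := by positivity
      simp only
      rcases max_cases 0 (Lag H z + c - K * ‖z.2‖) with h6 | h6
      · linarith [min_le_left A 0]
      · linarith [min_le_right A 0]⟩ ⟨v, hsub⟩ hint
    rw [integral_sub hLci (hfi c hc0.le),
      integral_add hLi (integrable_const c), hL0] at h
    simp only [integral_const, probReal_univ, one_smul, zero_add] at h
    have hmono : ∫ z, f 0 z ∂μ ≤ ∫ z, f c z ∂μ :=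
      integral_mono (hfi 0 le_rfl) (hfi c hc0.le) fun z =>
        mul_le_mul_of_nonneg_left (max_le_max le_rfl (by linarith)) (hψ0 z)
    linarith
  have hzero : ∫ z, f 0 z ∂μ = 0 := by
    refine le_antisymm ?_ (integral_nonneg (hf0 0))
    exact le_of_forall_pos_le_add fun η hη => by
      have := hbound (min η 1) (lt_min hη one_pos) (min_le_right _ _)
      linarith [min_le_left η 1]
  filter_upwards [(integral_eq_zero_iff_of_nonneg (hf0 0) (hfi 0 le_rfl)).1 hzero] with z hz hzR
  by_contra! hlt
  have : 0 < f 0 z := mul_pos (lt_min one_pos (lt_max_of_lt_right (by linarith)))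
    (lt_max_of_lt_right (by linarith))
  exact this.ne' hz

end Mather

section Existence

variable {N : ℕ} {H : Euc N × Euc N → ℝ}

theorem IsSubsol.mono {a b : ℝ} {u : Euc N → ℝ} (hu : IsSubsol H a u) (hab : a ≤ b) :
    IsSubsol H b u :=
  ⟨hu.1, hu.2.mono fun _ hx hd => (hx hd).trans hab⟩

theorem IsSubsol.subsolFor {a : ℝ} {u : Euc N → ℝ} (hu : IsSubsol H a u)
    (hFY : ∀ x p q : Euc N, ⟪p, q⟫ - H (x, p) ≤ Lag H (x, q)) :
    SubsolFor (fun z => Lag H z + a) u :=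
  ⟨hu.1, hu.2.mono fun x hx hd q => by linarith [fderiv_le_Lag_add hFY u x q, hx hd]⟩

theorem SubsolFor.linearCombination {Φ Ψ : Euc N × Euc N → ℝ} {u v : Euc N → ℝ}
    (hu : SubsolFor Φ u) (hv : SubsolFor Ψ v) {a b : ℝ} (ha : 0 ≤ a) (hb : 0 ≤ b) :
    SubsolFor (fun z => a * Φ z + b * Ψ z) fun x => a * u x + b * v x := by
  refine ⟨?_, ?_⟩
  · have hlin : ContDiff ℝ 1 fun w : ℝ × ℝ => a * w.1 + b * w.2 := by fun_prop
    exact hlin.locallyLipschitz.comp (hu.1.prodMk hv.1)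
  · filter_upwards [hu.2, hv.2, hu.1.ae_differentiableAt, hv.1.ae_differentiableAt]
      with x hux hvx hdu hdv _ q
    have h : HasFDerivAt (fun x => a * u x + b * v x) (a • fderiv ℝ u x + b • fderiv ℝ v x) x :=
      (hdu.hasFDerivAt.const_mul a).add (hdv.hasFDerivAt.const_mul b)
    rw [h.fderiv]
    exact add_le_add (mul_le_mul_of_nonneg_left (hux hdu q) ha)
      (mul_le_mul_of_nonneg_left (hvx hdv q) hb)

theorem subsolFor_zero : SubsolFor (0 : Euc N × Euc N → ℝ) 0 :=
  ⟨LocallyLipschitz.const 0, .of_forall fun x _ q => by simp⟩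

theorem SubsolFor.nonneg_zero {Φ : Euc N × Euc N → ℝ} {u : Euc N → ℝ} (hu : SubsolFor Φ u)
    (hΦ : Continuous Φ) (x : Euc N) : 0 ≤ Φ (x, 0) := by
  have hcl : IsClosed {x : Euc N | 0 ≤ Φ (x, 0)} :=
    isClosed_le continuous_const (by fun_prop)
  have hae : ∀ᵐ x : Euc N ∂volume, 0 ≤ Φ (x, 0) := by
    filter_upwards [hu.2, hu.1.ae_differentiableAt] with x hx hd
    simpa using hx hd 0
  have hdense : Dense {x : Euc N | 0 ≤ Φ (x, 0)} := Measure.dense_of_ae hae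
  exact hcl.closure_subset (hdense x)

theorem matherMeasure_map_iff {K : Set (Euc N × Euc N)} (hK : IsCompact K)
    (hLc : Continuous (Lag H)) (ν : ProbabilityMeasure K) :
    MatherMeasure H ((ν : Measure K).map Subtype.val) ↔
      ∫ z : K, Lag H z ∂(ν : Measure K) = 0 ∧
        ∀ Φ : Euc N × Euc N → ℝ, Continuous Φ → BddBelow (Set.range Φ) →
          (∃ u, SubsolFor Φ u) → 0 ≤ ∫ z : K, Φ z ∂(ν : Measure K) := by
  have : CompactSpace K := isCompact_iff_compactSpace.1 hK
  have hval : Measurable (Subtype.val : K → Euc N × Euc N) := measurable_subtype_coe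
  have hprob : IsProbabilityMeasure ((ν : Measure K).map Subtype.val) :=
    Measure.isProbabilityMeasure_map hval.aemeasurable
  have hint : ∀ f : Euc N × Euc N → ℝ, Continuous f →
      Integrable f ((ν : Measure K).map Subtype.val) := fun f hf =>
    (integrable_map_measure hf.aestronglyMeasurable hval.aemeasurable).2
      ((hf.comp continuous_subtype_val).integrable_of_hasCompactSupport
        (HasCompactSupport.of_compactSpace _))
  have hmap : ∀ f : Euc N × Euc N → ℝ, Continuous f →
      ∫ z, f z ∂((ν : Measure K).map Subtype.val) = ∫ z : K, f z ∂(ν : Measure K) :=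
    fun f hf => integral_map hval.aemeasurable hf.aestronglyMeasurable
  constructor
  · rintro ⟨_, _, hL0, hΦ⟩
    refine ⟨hmap _ hLc ▸ hL0, fun Φ hc hb hs => ?_⟩
    rw [← hmap Φ hc]
    exact hΦ Φ hc hb hs (hint Φ hc)
  · rintro ⟨hL0, hΦ⟩
    refine ⟨hprob, hint _ hLc, (hmap _ hLc).trans hL0, fun Φ hc hb hs _ => ?_⟩
    rw [hmap Φ hc]
    exact hΦ Φ hc hb hs

theorem isCompact_setOf_matherMeasure {K : Set (Euc N × Euc N)} (hK : IsCompact K)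
    (hLc : Continuous (Lag H)) (hsupp : ∀ μ, MatherMeasure H μ → ∀ᵐ z ∂μ, z ∈ K) :
    IsCompact {μ : ProbabilityMeasure (Euc N × Euc N) |
      MatherMeasure H (μ : Measure (Euc N × Euc N))} := by
  have : CompactSpace K := isCompact_iff_compactSpace.1 hK
  have hcont : ∀ f : Euc N × Euc N → ℝ, Continuous f →
      Continuous fun ν : ProbabilityMeasure K => ∫ z : K, f z ∂(ν : Measure K) := fun f hf =>
    ProbabilityMeasure.continuous_integral_continuousMap
      (⟨fun z => f z, hf.comp continuous_subtype_val⟩ : C(K, ℝ))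
  have hclosed : IsClosed {ν : ProbabilityMeasure K |
      MatherMeasure H ((ν : Measure K).map Subtype.val)} := by
    simp only [matherMeasure_map_iff hK hLc]
    refine (isClosed_eq (hcont _ hLc) continuous_const).and ?_
    simp only [Set.ofPred_forall]
    exact isClosed_iInter fun Φ => isClosed_iInter fun hc => isClosed_iInter fun _ =>
      isClosed_iInter fun _ => isClosed_le continuous_const (hcont Φ hc)
  convert hclosed.isCompact.image
    (ProbabilityMeasure.continuous_map (f := (Subtype.val : K → Euc N × Euc N))
      continuous_subtype_val) using 1
  ext μ
  constructor
  · intro hμ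
    have hmap : ((μ : Measure (Euc N × Euc N)).comap (Subtype.val : K → Euc N × Euc N)).map
        Subtype.val = μ := by
      rw [map_comap_subtype_coe hK.measurableSet, Measure.restrict_eq_self_of_ae_mem (hsupp _ hμ)]
    have hprob : IsProbabilityMeasure
        ((μ : Measure (Euc N × Euc N)).comap (Subtype.val : K → Euc N × Euc N)) := by
      refine ⟨?_⟩
      have h : (((μ : Measure (Euc N × Euc N)).comap (Subtype.val : K → Euc N × Euc N)).map
        Subtype.val) univ = 1 := by
        rw [hmap]
        exact measure_univ
      rwa [Measure.map_apply measurable_subtype_coe .univ, preimage_univ] at h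
    refine ⟨⟨_, hprob⟩, ?_, Subtype.ext hmap⟩
    change MatherMeasure H (Measure.map _ _)
    rw [ProbabilityMeasure.coe_mk, hmap]
    exact hμ
  · rintro ⟨ν, hν, rfl⟩
    exact hν

/-- If subsolutions of negative level do not exist, and comparison of a subsolution with the
Lagrangian on the compact set `K` produces a subsolution of `H`, then Mather measures exist. -/
theorem exists_matherMeasure {K : Set (Euc N × Euc N)} (hK : IsCompact K)
    (h0K : (0 : Euc N × Euc N) ∈ K) (hLc : Continuous (Lag H))
    (hFY : ∀ x p q : Euc N, ⟪p, q⟫ - H (x, p) ≤ Lag H (x, q))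
    (hv : ∀ c > (0 : ℝ), ∃ v, IsSubsol H c v)
    (hneg : ∀ Φ u, ∀ c > (0 : ℝ), SubsolFor Φ u → ¬ ∀ z ∈ K, Φ z ≤ Lag H z - c) :
    ∃ μ : ProbabilityMeasure (Euc N × Euc N), MatherMeasure H (μ : Measure (Euc N × Euc N)) := by
  have : CompactSpace K := isCompact_iff_compactSpace.1 hK
  have : Nonempty K := ⟨⟨0, h0K⟩⟩
  let G : Set C(K, ℝ) := {f | ∃ Φ : Euc N × Euc N → ℝ, Continuous Φ ∧ (∃ u, SubsolFor Φ u) ∧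
    ∃ s : ℝ, 0 ≤ s ∧ ∀ z : K, f z = Φ z - s * Lag H z}
  have hG0 : (0 : C(K, ℝ)) ∈ G :=
    ⟨0, continuous_const, ⟨0, subsolFor_zero⟩, 0, le_rfl, fun z => by simp⟩
  have hGlin : ∀ f ∈ G, ∀ g ∈ G, ∀ a b : ℝ, 0 ≤ a → 0 ≤ b → a • f + b • g ∈ G := by
    rintro f ⟨Φ, hΦ, ⟨u, hu⟩, s, hs, hf⟩ g ⟨Ψ, hΨ, ⟨v, hv⟩, t, ht, hg⟩ a b ha hb
    refine ⟨_, by fun_prop, ⟨_, hu.linearCombination hv ha hb⟩, a * s + b * t, by positivity,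
      fun z => ?_⟩
    simp only [ContinuousMap.add_apply, ContinuousMap.smul_apply, smul_eq_mul, hf, hg]
    ring
  have hGn : ∀ g ∈ G, ∃ z, 0 ≤ g z := by
    rintro g ⟨Φ, hΦ, ⟨u, hu⟩, s, hs, hg⟩
    rcases hs.eq_or_lt with rfl | hs
    · exact ⟨⟨0, h0K⟩, by rw [hg, zero_mul, sub_zero]; exact hu.nonneg_zero hΦ 0⟩
    by_contra! hlt
    obtain ⟨z₀, -, hz₀⟩ := isCompact_univ.exists_isMaxOn univ_nonempty g.continuous.continuousOn
    refine hneg _ _ (-g z₀ / s) (div_pos (neg_pos.2 (hlt z₀)) hs)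
      (hu.linearCombination subsolFor_zero (inv_nonneg.2 hs.le) le_rfl) fun z hz => ?_
    have h1 : g ⟨z, hz⟩ ≤ g z₀ := hz₀ (mem_univ _)
    rw [hg ⟨z, hz⟩] at h1
    rw [neg_div, sub_neg_eq_add, zero_mul, add_zero, inv_mul_le_iff₀ hs, mul_add,
      mul_div_cancel₀ _ hs.ne']
    simp only at h1
    linarith
  obtain ⟨ν, hν⟩ := exists_probabilityMeasure_integral_nonneg hG0
    (fun f hf g hg a b ha hb _ => hGlin f hf g hg a b ha hb)
    (fun g hg t ht => by simpa using hGlin g hg 0 hG0 t 0 ht le_rfl) hGn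
  have hΦ : ∀ Φ : Euc N × Euc N → ℝ, Continuous Φ → (∃ u, SubsolFor Φ u) →
      0 ≤ ∫ z : K, Φ z ∂(ν : Measure K) := fun Φ hc hs =>
    hν ⟨fun z => Φ z, hc.comp continuous_subtype_val⟩ ⟨Φ, hc, hs, 0, le_rfl, fun z => by simp⟩
  have hLi : Integrable (fun z : K => Lag H z) (ν : Measure K) :=
    (hLc.comp continuous_subtype_val).integrable_of_hasCompactSupport
      (HasCompactSupport.of_compactSpace _)
  have hle : ∫ z : K, Lag H z ∂(ν : Measure K) ≤ 0 := by
    have h := hν ⟨fun z => -Lag H z, (hLc.comp continuous_subtype_val).neg⟩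
      ⟨0, continuous_const, ⟨0, subsolFor_zero⟩, 1, zero_le_one, fun z => by simp⟩
    simp only [ContinuousMap.coe_mk] at h
    rw [integral_neg] at h
    linarith
  have hge : 0 ≤ ∫ z : K, Lag H z ∂(ν : Measure K) :=
    le_of_forall_pos_le_add fun c hc => by
      obtain ⟨v, hv⟩ := hv c hc
      have h := hΦ _ (by fun_prop) ⟨v, hv.subsolFor hFY⟩
      rw [integral_add hLi (integrable_const c)] at h
      simpa using h
  exact ⟨ν.map measurable_subtype_coe.aemeasurable, (matherMeasure_map_iff hK hLc ν).2
    ⟨le_antisymm hle hge, fun Φ hc _ hs => hΦ Φ hc hs⟩⟩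

end Existence

theorem stmt14 {N : ℕ} (hN : 1 ≤ N) (H : Euc N × Euc N → ℝ)
    (hA1 : Continuous H)
    (hA2conv : ∀ x : Euc N, ConvexOn ℝ Set.univ fun p => H (x, p))
    (hA2coer : ∀ R : ℝ, 0 < R → ∀ C : ℝ, ∃ r : ℝ, ∀ x p : Euc N,
      ‖x‖ ≤ R → r ≤ ‖p‖ → C ≤ H (x, p))
    (hA3 : ∃ ε > (0 : ℝ), ∃ m : ℝ,
      (∃ R : ℝ, ∀ x : Euc N, R ≤ ‖x‖ → ∀ p : Euc N, ‖p‖ ≤ ε → H (x, p) ≤ m) ∧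
      (∃ x₀ : Euc N, ∀ p : Euc N, m < H (x₀, p)))
    (hcrit : sInf {a : ℝ | ∃ u : Euc N → ℝ, IsSubsol H a u} = 0)
    (hsl : ∀ x : Euc N, ∀ C : ℝ, ∃ r : ℝ, ∀ p : Euc N, r ≤ ‖p‖ → C * ‖p‖ ≤ H (x, p))
 :
    {μ : ProbabilityMeasure (Euc N × Euc N) |
      MatherMeasure H (μ : Measure (Euc N × Euc N))}.Nonempty ∧
    IsCompact {μ : ProbabilityMeasure (Euc N × Euc N) |
      MatherMeasure H (μ : Measure (Euc N × Euc N))} := by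


  obtain ⟨ε, hε, m, ⟨R, hH⟩, x₀, hx₀⟩ := hA3
  obtain ⟨hm, hlb, hub⟩ := lt_zero_and_critical hA1 hA2coer hε hH hx₀ hcrit
  obtain ⟨R', hR', hrad⟩ := exists_radius_isSubsol hA2coer hε hH
  have hLc : Continuous (Lag H) := continuous_Lag hA1 hA2conv hsl
  have hFY := inner_sub_le_Lag hA1 hsl
  have hsub : ∀ c > (0 : ℝ), ∃ v, IsSubsol H c v := fun c hc => by
    obtain ⟨a, -, hac, u, hu⟩ := hub c hc
    exact ⟨u, hu.mono hac.le⟩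
  constructor
  · obtain ⟨r, hr, hleft⟩ := exists_forall_le_of_inner_le_Lag hA1 hA2conv hA2coer hsl hR'
    refine exists_matherMeasure (K := closedBall 0 R' ×ˢ closedBall 0 r)
      ((isCompact_closedBall _ _).prod (isCompact_closedBall _ _))
      ⟨mem_closedBall_self hR'.le, mem_closedBall_self hr⟩ hLc hFY hsub
      fun Φ u c hc hu hle => ?_
    obtain ⟨v, hv, -⟩ := hrad (max (-c) m) (le_max_right _ _)
      (max_le (by linarith) (by linarith)) u hu.1 <| by
        filter_upwards [hu.2] with x hx hxR hd
        refine (hleft x _ hxR.le (-c) (by linarith) fun q hq => ?_).trans (le_max_left _ _)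
        rw [inner_gradient]
        exact (hx hd q).trans (hle (x, q)
          ⟨mem_closedBall_zero_iff.2 hxR.le, mem_closedBall_zero_iff.2 hq⟩)
    exact (max_lt (neg_lt_zero.2 hc) hm).not_ge (hlb _ v hv)
  · obtain ⟨A, hA⟩ : ∃ A, ∀ z, A ≤ Lag H z := by
      obtain ⟨A, hA⟩ := (isCompact_closedBall (0 : Euc N) R).bddAbove_image
        (f := fun x => H (x, 0)) (by fun_prop)
      refine ⟨-max A m, fun ⟨x, q⟩ => ?_⟩
      have h1 : H (x, 0) ≤ max A m := by
        rcases le_total R ‖x‖ with hx | hx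
        · exact (hH x hx 0 (by simpa using hε.le)).trans (le_max_right _ _)
        · exact (hA ⟨x, mem_closedBall_zero_iff.2 hx, rfl⟩).trans (le_max_left _ _)
      have h2 := hFY x 0 q
      rw [inner_zero_left] at h2
      linarith
    obtain ⟨K, hK⟩ := hA2coer (R' + 1) (by linarith) 2
    obtain ⟨B, hB⟩ := exists_mul_norm_sub_le_Lag hA1 hsl R'
      (C := max K 0 + 1) (by positivity)
    refine isCompact_setOf_matherMeasure (K := closedBall 0 R' ×ˢ closedBall 0 B)
      ((isCompact_closedBall _ _).prod (isCompact_closedBall _ _)) hLc fun μ hμ => ?_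
    have hfst := hμ.ae_norm_fst_le hLc hA hFY hm fun c hc hc1 => by
      obtain ⟨u, hu⟩ := hsub c hc
      exact hrad c (by linarith) hc1 u hu.1 (hu.2.mono fun x hx _ => hx)
    filter_upwards [hfst, hμ.ae_Lag_le hLc hA hFY (fun c hc _ => hsub c hc) (R := R')
      (le_max_right K 0) fun x p hx hp => hK x p hx ((le_max_left _ _).trans hp)] with z hz1 hz2
    have h1 := hB z.1 z.2 hz1
    have h2 := hz2 hz1
    refine ⟨mem_closedBall_zero_iff.2 hz1, mem_closedBall_zero_iff.2 ?_⟩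
    linarith

end
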